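/- Generalized half-Brunn–Minkowski inequality: let (X,d,m,G) be a gauge metric measure space satisfying MCP(β) for a distortion coefficient β as in the context. Let A ⊆ X be a Borel set with m(A) > 0 and let x̄ ∈ supp m with m({x̄} ∩ A) = 0. Then for every t ∈ (0,1): m̄(A_t) ≥ β_t({x̄},A)·m(A), where A_t = Z_t({x̄},A) is the set of t-intermediate points between {x̄} and A, with the convention 0·∞ = 0. -/

import Mathlib

open MeasureTheory Filter Set Metric ENNReal Topology

noncomputable section

namespace GMMS

variable {X : Type*}

open Classical in
/-- The support of a Borel measure on a metric space: points all of whose balls have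
positive measure. -/
def mSupp [PseudoMetricSpace X] [MeasurableSpace X] (m : Measure X) : Set X :=
  {x : X | ∀ r : ℝ, 0 < r → 0 < m (Metric.ball x r)}

/-- A measure which is finite on every bounded set. -/
def FiniteOnBounded [PseudoMetricSpace X] [MeasurableSpace X] (m : Measure X) : Prop :=
  ∀ s : Set X, Bornology.IsBounded s → m s < ⊤

open Classical in
/-- The nonnegative part of an extended real number, in `[0,∞]`. -/
def epos (x : EReal) : ℝ≥0∞ := if x = ⊤ then ⊤ else ENNReal.ofReal x.toReal

/-- Integral of an `EReal`-valued function, defined as the difference of the lower integrals of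
the positive and negative parts (with the `EReal` convention `⊤ - ⊤ = ⊥`). -/
def eintegral {α : Type*} [MeasurableSpace α] (ν : Measure α) (f : α → EReal) : EReal :=
  ((∫⁻ a, epos (f a) ∂ν : ℝ≥0∞) : EReal) - ((∫⁻ a, epos (-(f a)) ∂ν : ℝ≥0∞) : EReal)

/-- `𝒟 = inf {θ > 0 | s θ = 0} ∈ (0,+∞]`. -/
def Dcal (s : ℝ → ℝ) : ℝ≥0∞ :=
  sInf (ENNReal.ofReal '' {θ : ℝ | 0 < θ ∧ s θ = 0})

/-- The distortion coefficient `β` associated with the data `(s, N)`: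
`β t 0 = t ^ N`, `β t θ = s (t θ) / s θ` for `0 < θ < 𝒟`, and
`β t θ = liminf_{φ → 𝒟⁻} s (t φ) / s φ` for `θ ≥ 𝒟`. -/
def beta (s : ℝ → ℝ) (N : ℝ) (t : ℝ) (θ : ℝ≥0∞) : ℝ≥0∞ :=
  if θ = 0 then ENNReal.ofReal (t ^ N)
  else if θ < Dcal s then ENNReal.ofReal (s (t * θ.toReal) / s θ.toReal)
  else Filter.liminf (fun φ : ℝ≥0∞ => ENNReal.ofReal (s (t * φ.toReal) / s φ.toReal))
      (nhdsWithin (Dcal s) (Set.Iio (Dcal s)))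

open Classical in
/-- The data `(s, N)` defining a distortion coefficient: `N ∈ [1,∞)`, `s` continuous on `[0,∞)`
with `s θ = c θ^N + o(θ^N)` as `θ → 0⁺`, for some `c > 0`. -/
structure DistortionData (s : ℝ → ℝ) (N : ℝ) : Prop where
  one_le : 1 ≤ N
  cont : ContinuousOn s (Set.Ici 0)
  asymp : ∃ c : ℝ, 0 < c ∧
    (fun θ : ℝ => s θ - c * θ ^ N) =o[nhdsWithin 0 (Set.Ioi 0)] (fun θ : ℝ => θ ^ N)

/-- The space of (constant-speed, defined on `[0,1]`) geodesics of a metric space. -/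
abbrev GeoSpace (X : Type*) [MetricSpace X] : Type _ :=
  {γ : C(unitInterval, X) //
    ∀ s t : unitInterval, dist (γ s) (γ t) = |(s : ℝ) - (t : ℝ)| * dist (γ 0) (γ 1)}

instance [MetricSpace X] : MeasurableSpace (GeoSpace X) := borel _

/-- Evaluation of a geodesic at time `t ∈ [0,1]`. -/
def geval [MetricSpace X] (γ : GeoSpace X) (t : ℝ) : X :=
  γ.1 (Set.projIcc 0 1 zero_le_one t)

/-- The squared quadratic Kantorovich-Rubinstein-Wasserstein transportation cost. -/
def W2sq [MetricSpace X] [MeasurableSpace X] (μ ν : Measure X) : ℝ≥0∞ :=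
  ⨅ (π : Measure (X × X)) (_ : π.map Prod.fst = μ) (_ : π.map Prod.snd = ν),
    ∫⁻ p, edist p.1 p.2 ^ 2 ∂π

/-- A `W₂`-geodesic: a curve of probability measures with finite second moment such that
`W₂(μ_s, μ_t) = |s - t| W₂(μ_0, μ_1)`. -/
structure IsW2Geo [MetricSpace X] [MeasurableSpace X] (μ : ℝ → Measure X) : Prop where
  prob : ∀ t ∈ Set.Icc (0:ℝ) 1, IsProbabilityMeasure (μ t)
  moment : ∀ t ∈ Set.Icc (0:ℝ) 1, ∃ x₀ : X, ∫⁻ x, edist x x₀ ^ 2 ∂(μ t) < ⊤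
  geo : ∀ s ∈ Set.Icc (0:ℝ) 1, ∀ t ∈ Set.Icc (0:ℝ) 1,
    W2sq (μ s) (μ t) = ENNReal.ofReal ((s - t) ^ 2) * W2sq (μ 0) (μ 1)

/-- Optimal dynamical plans from `μ0` to `μ1`. -/
def OptGeoSet [MetricSpace X] [MeasurableSpace X] (μ0 μ1 : Measure X) :
    Set (Measure (GeoSpace X)) :=
  {ν | IsProbabilityMeasure ν ∧
    (ν.map fun γ => (geval γ 0, geval γ 1)).map Prod.fst = μ0 ∧
    (ν.map fun γ => (geval γ 0, geval γ 1)).map Prod.snd = μ1 ∧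
    ∫⁻ p, edist p.1 p.2 ^ 2 ∂(ν.map fun γ => (geval γ 0, geval γ 1)) = W2sq μ0 μ1}

open Classical in
/-- The Boltzmann-Shannon relative entropy `Ent(μ|m) = ∫ ρ log ρ dm` if `μ = ρ m` with
`ρ log ρ ∈ L¹(m)`, and `+∞` otherwise. -/
def Ent [MeasurableSpace X] (μ m : Measure X) : EReal :=
  if μ ≪ m ∧
      Integrable (fun x => (μ.rnDeriv m x).toReal * Real.log (μ.rnDeriv m x).toReal) m
  then ((∫ x, (μ.rnDeriv m x).toReal * Real.log (μ.rnDeriv m x).toReal ∂m : ℝ) : EReal)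
  else (⊤ : EReal)

/-- The dimensional entropy `U_n(μ|m) = exp (-Ent(μ|m)/n)`, with value `0` when
`Ent(μ|m) = +∞`. -/
def UnE [MeasurableSpace X] (n : ℝ) (μ m : Measure X) : ℝ≥0∞ :=
  EReal.exp (((n⁻¹ : ℝ) : EReal) * (-(Ent μ m)))

/-- Probability measures with bounded support contained in `supp m`. -/
def Pbs [MetricSpace X] [MeasurableSpace X] (m : Measure X) : Set (Measure X) :=
  {μ | IsProbabilityMeasure μ ∧ Bornology.IsBounded (mSupp μ) ∧ mSupp μ ⊆ mSupp m}

/-- Probability measures with bounded support contained in `supp m` and finite entropy. -/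
def PbsStar [MetricSpace X] [MeasurableSpace X] (m : Measure X) : Set (Measure X) :=
  {μ | μ ∈ Pbs m ∧ Ent μ m ≠ ⊤}

/-- The coefficient `exp ((1/n) ∫ log (f γ) dν(γ))` appearing in the `CD(β,n)` inequality. -/
def cdCoeff [MetricSpace X] (n : ℝ) (ν : Measure (GeoSpace X)) (f : GeoSpace X → ℝ≥0∞) :
    ℝ≥0∞ :=
  EReal.exp (((n⁻¹ : ℝ) : EReal) * eintegral ν fun γ => ENNReal.log (f γ))

/-- The `CD` convexity inequality along the dynamical plan `ν`, for a coefficient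
`b : [0,1] × [0,∞] → [0,∞]` (with the conventions `∞ ⬝ 0 = 0` of `ℝ≥0∞`). -/
def CDineq [MetricSpace X] [MeasurableSpace X] (m : Measure X) (G : X → X → ℝ≥0∞)
    (b : ℝ → ℝ≥0∞ → ℝ≥0∞) (n : ℝ) (μ0 μ1 : Measure X) (ν : Measure (GeoSpace X)) : Prop :=
  ∀ t ∈ Set.Ioo (0:ℝ) 1,
    cdCoeff n ν (fun γ => b (1 - t) (G (geval γ 1) (geval γ 0))) * UnE n μ0 m
      + cdCoeff n ν (fun γ => b t (G (geval γ 0) (geval γ 1))) * UnE n μ1 m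
      ≤ UnE n (ν.map fun γ => geval γ t) m

/-- The curvature-dimension condition `CD(b, n)` for the gauge metric measure space
`(X, d, m, G)`. -/
def CD [MetricSpace X] [MeasurableSpace X] (m : Measure X) (G : X → X → ℝ≥0∞)
    (b : ℝ → ℝ≥0∞ → ℝ≥0∞) (n : ℝ) : Prop :=
  ∀ μ0 ∈ Pbs m, ∀ μ1 ∈ PbsStar m, mSupp μ0 ∩ mSupp μ1 = ∅ →
    ∃ ν ∈ OptGeoSet μ0 μ1, CDineq m G b n μ0 μ1 ν

/-- The strong curvature-dimension condition: the `CD` inequality holds along every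
optimal dynamical plan. -/
def CDStrong [MetricSpace X] [MeasurableSpace X] (m : Measure X) (G : X → X → ℝ≥0∞)
    (b : ℝ → ℝ≥0∞ → ℝ≥0∞) (n : ℝ) : Prop :=
  ∀ μ0 ∈ Pbs m, ∀ μ1 ∈ PbsStar m, mSupp μ0 ∩ mSupp μ1 = ∅ →
    ∀ ν ∈ OptGeoSet μ0 μ1, CDineq m G b n μ0 μ1 ν

/-- The measure contraction property `MCP(b)` for the gauge metric measure space
`(X, d, m, G)`. -/
def MCP [MetricSpace X] [MeasurableSpace X] (m : Measure X) (G : X → X → ℝ≥0∞)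
    (b : ℝ → ℝ≥0∞ → ℝ≥0∞) : Prop :=
  ∀ x ∈ mSupp m, ∀ μ1 ∈ PbsStar m, x ∉ mSupp μ1 →
    ∃ μ : ℝ → Measure X, IsW2Geo μ ∧ μ 0 = Measure.dirac x ∧ μ 1 = μ1 ∧
      ∀ t ∈ Set.Ioo (0:ℝ) 1, ∀ n : ℝ, 1 ≤ n →
        EReal.exp (((n⁻¹ : ℝ) : EReal) * eintegral μ1 fun y => ENNReal.log (b t (G x y)))
            * UnE n μ1 m
          ≤ UnE n (μ t) m

/-- The set of `t`-intermediate points between `A0` and `A1`. -/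
def Zt [MetricSpace X] (t : ℝ) (A0 A1 : Set X) : Set X :=
  {x | ∃ γ : GeoSpace X, geval γ 0 ∈ A0 ∧ geval γ 1 ∈ A1 ∧ geval γ t = x}

/-- The distortion coefficient `β_t(A0, A1)` between two sets. -/
def betaSet [MetricSpace X] [MeasurableSpace X] (m : Measure X) (G : X → X → ℝ≥0∞)
    (b : ℝ≥0∞ → ℝ≥0∞) (A0 A1 : Set X) : ℝ≥0∞ :=
  ⨆ (A0' : Set X) (_ : A0' ⊆ A0) (_ : A0'.Nonempty) (_ : m (A0 \ A0') = 0)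
    (A1' : Set X) (_ : A1' ⊆ A1) (_ : A1'.Nonempty) (_ : m (A1 \ A1') = 0),
    ⨅ (x0 : X) (_ : x0 ∈ A0' ∩ mSupp m) (x1 : X) (_ : x1 ∈ A1' ∩ mSupp m), b (G x0 x1)

/-- The "true" distortion coefficient of a metric measure space. -/
def trueBeta [MetricSpace X] [MeasurableSpace X] (m : Measure X) (t : ℝ) (x y : X) : ℝ≥0∞ :=
  Filter.limsup (fun r : ℝ => m (Zt t {x} (Metric.ball y r)) / m (Metric.ball y r))
    (nhdsWithin 0 (Set.Ioi 0))

/-- The `G`-diameter of a set. -/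
def diamG [MetricSpace X] [MeasurableSpace X] (m : Measure X) (G : X → X → ℝ≥0∞)
    (S : Set X) : ℝ≥0∞ :=
  ⨆ x ∈ S, essSup (fun y => G x y) (m.restrict (S \ {x}))

/-- The quantity `C_σ(x)` entering the definition of the geodesic dimension. -/
def Csig [MetricSpace X] [MeasurableSpace X] (m : Measure X) (σ : ℝ) (x : X) : ℝ≥0∞ :=
  ⨆ (A : Set X) (_ : MeasurableSet A) (_ : Bornology.IsBounded A) (_ : x ∉ A)
    (_ : 0 < m A) (_ : m A < ⊤),
    Filter.limsup (fun t : ℝ => ENNReal.ofReal (t ^ (-σ)) * m (Zt t {x} A) / m A)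
      (nhdsWithin 0 (Set.Ioi 0))

/-- The geodesic dimension at a point. -/
def dimGeo [MetricSpace X] [MeasurableSpace X] (m : Measure X) (x : X) : ℝ≥0∞ :=
  sInf (ENNReal.ofReal '' {σ : ℝ | 0 < σ ∧ Csig m σ x = ⊤})

/-- The geodesic dimension of a set. -/
def dimGeoS [MetricSpace X] [MeasurableSpace X] (m : Measure X) (S : Set X) : ℝ≥0∞ :=
  ⨆ x ∈ S, dimGeo m x

/-- The gauge `G` is meek. -/
def Meek [MetricSpace X] [MeasurableSpace X] (m : Measure X) (G : X → X → ℝ≥0∞) : Prop :=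
  ∀ x ∈ mSupp m, ∀ μ1 ∈ PbsStar m, x ∉ mSupp μ1 →
    ∀ ν ∈ OptGeoSet (Measure.dirac x) μ1,
      ∃ Γ : Set (GeoSpace X), MeasurableSet Γ ∧ ν Γ = 1 ∧
        ∀ γ ∈ Γ, ∀ t ∈ Set.Ioc (0:ℝ) 1,
          G (geval γ 0) (geval γ t) = ENNReal.ofReal t * G (geval γ 0) (geval γ 1)

/-- The measure `v_G(x₀, r, ρ)` of the intersection of a gauge sublevel set with a metric
ball. -/
def vG [MetricSpace X] [MeasurableSpace X] (m : Measure X) (G : X → X → ℝ≥0∞)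
    (x0 : X) (r ρ : ℝ) : ℝ≥0∞ :=
  m {x | G x0 x ≤ ENNReal.ofReal r ∧ dist x0 x ≤ ρ}

/-- `(supp m, d)` is a geodesic space: any two points of the support are joined by a geodesic
contained in the support. -/
def GeodesicSupp [MetricSpace X] [MeasurableSpace X] (m : Measure X) : Prop :=
  ∀ x ∈ mSupp m, ∀ y ∈ mSupp m, ∃ γ : GeoSpace X,
    geval γ 0 = x ∧ geval γ 1 = y ∧ ∀ t ∈ Set.Icc (0:ℝ) 1, geval γ t ∈ mSupp m

section Transport

variable [MetricSpace X]

/-- The relation satisfied by the points `x`, `y` reached at times `q ≤ r` along a geodesic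
issuing from `o`. -/
def OnRay (o : X) (q r : ℝ) (x y : X) : Prop :=
  q * dist o y = r * dist o x ∧ q * dist x y = (r - q) * dist o x

/-- The defect of the pair `(x, y)` from satisfying `OnRay o q r x y`. -/
def rayDefect (o : X) (q r : ℝ) (p : X × X) : ℝ :=
  r * (r - q) * dist o p.1 ^ 2 + r * q * dist p.1 p.2 ^ 2 - q * (r - q) * dist o p.2 ^ 2

lemma continuous_rayDefect (o : X) (q r : ℝ) : Continuous (rayDefect o q r) := by
  unfold rayDefect; fun_prop

lemma rayDefect_eq (o : X) (q r : ℝ) (p : X × X) :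
    rayDefect o q r p = ((r - q) * dist o p.1 - q * dist p.1 p.2) ^ 2 +
      q * (r - q) * ((dist o p.1 + dist p.1 p.2) ^ 2 - dist o p.2 ^ 2) := by
  unfold rayDefect; ring

lemma sq_dist_le_sq_add (o x y : X) : 0 ≤ (dist o x + dist x y) ^ 2 - dist o y ^ 2 := by
  have h := dist_triangle o x y
  have h0 : 0 ≤ dist o y := dist_nonneg
  nlinarith

lemma rayDefect_nonneg (o : X) {q r : ℝ} (hq : 0 ≤ q) (hqr : q ≤ r) (p : X × X) :
    0 ≤ rayDefect o q r p := by
  rw [rayDefect_eq]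
  have h1 := mul_nonneg (mul_nonneg hq (sub_nonneg.2 hqr)) (sq_dist_le_sq_add o p.1 p.2)
  positivity

lemma OnRay.of_rayDefect {o : X} {q r : ℝ} (hq : 0 < q) (hqr : q < r) {p : X × X}
    (h : rayDefect o q r p ≤ 0) : OnRay o q r p.1 p.2 := by
  rw [rayDefect_eq] at h
  have h1 := sq_dist_le_sq_add o p.1 p.2
  have hpos : 0 < q * (r - q) := mul_pos hq (sub_pos.2 hqr)
  have h2 := mul_nonneg hpos.le h1
  have h3 : (r - q) * dist o p.1 - q * dist p.1 p.2 = 0 := by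
    apply pow_eq_zero_iff two_ne_zero |>.1
    nlinarith [sq_nonneg ((r - q) * dist o p.1 - q * dist p.1 p.2)]
  have h4 : q * (r - q) * ((dist o p.1 + dist p.1 p.2) ^ 2 - dist o p.2 ^ 2) = 0 := by
    nlinarith [sq_nonneg ((r - q) * dist o p.1 - q * dist p.1 p.2)]
  have h5 : (dist o p.1 + dist p.1 p.2) ^ 2 = dist o p.2 ^ 2 := by
    rcases mul_eq_zero.1 h4 with h | h
    · exact absurd h hpos.ne'
    · linarith
  have h6 : dist o p.1 + dist p.1 p.2 = dist o p.2 :=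
    (pow_left_inj₀ (by positivity) dist_nonneg two_ne_zero).1 h5
  refine ⟨?_, by linarith⟩
  rw [← h6]; linarith

lemma OnRay.trans {o : X} {q r u : ℝ} (hq : 0 ≤ q) (hqr : q < r) {x y z : X}
    (h1 : OnRay o q r x y) (h2 : OnRay o r u y z) : OnRay o q u x z := by
  have hr : 0 < r := hq.trans_lt hqr
  have e1 : q * dist o z = u * dist o x := by
    apply mul_left_cancel₀ hr.ne'
    linear_combination q * h2.1 + u * h1.1
  have e2 : q * dist y z = (u - r) * dist o x := by
    apply mul_left_cancel₀ hr.ne'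
    linear_combination q * h2.2 + (u - r) * h1.1
  refine ⟨e1, le_antisymm ?_ ?_⟩
  · have := mul_le_mul_of_nonneg_left (dist_triangle x y z) hq
    linarith [h1.2]
  · have := mul_le_mul_of_nonneg_left (dist_triangle o x z) hq
    linarith

lemma OnRay.zero (o : X) (r : ℝ) (y : X) : OnRay o 0 r o y := by
  simp [OnRay]

lemma isClosed_onRay (o : X) (q r : ℝ) : IsClosed {p : X × X | OnRay o q r p.1 p.2} :=
  (isClosed_eq (by fun_prop) (by fun_prop)).inter (isClosed_eq (by fun_prop) (by fun_prop))

/-- A map scaling distances by `L` on a dense set of times extends to a geodesic. -/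
lemma exists_geodesic_extension [CompleteSpace X] {D : Set unitInterval} (hD : Dense D)
    (h0 : (0 : unitInterval) ∈ D) (h1 : (1 : unitInterval) ∈ D) (x : D → X) (L : ℝ)
    (hx : ∀ q r : D, dist (x q) (x r) = |((q : unitInterval) : ℝ) - (r : unitInterval)| * L) :
    ∃ γ : GeoSpace X, ∀ q : D, γ.1 q = x q := by
  have hL : dist (x ⟨0, h0⟩) (x ⟨1, h1⟩) = L := by simp [hx]
  have hL0 : 0 ≤ L := hL ▸ dist_nonneg
  have hlip : UniformContinuous x := by
    refine (LipschitzWith.of_dist_le_mul (K := L.toNNReal) fun q r => ?_).uniformContinuous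
    rw [hx, Real.coe_toNNReal _ hL0, mul_comm]
    rfl
  have hind : IsUniformInducing ((↑) : D → unitInterval) := isUniformInducing_val D
  have hdense : DenseRange ((↑) : D → unitInterval) := hD.denseRange_val
  set g := (hind.isDenseInducing hdense).extend x with hg
  have hgu : UniformContinuous g := uniformContinuous_uniformly_extend hind hdense hlip
  have hgx : ∀ q : D, g q = x q := uniformly_extend_of_ind hind hdense hlip
  have hgd : ∀ q r : unitInterval, dist (g q) (g r) = |(q : ℝ) - r| * L := by
    refine hdense.induction_on₂ (isClosed_eq ?_ ?_) fun q r => by rw [hgx, hgx, hx]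
    · have := hgu.continuous; fun_prop
    · fun_prop
  have hend : dist (g 0) (g 1) = L := by simp [hgd]
  exact ⟨⟨⟨g, hgu.continuous⟩, fun q r => by simpa [hend] using hgd q r⟩, hgx⟩

lemma ofReal_mul_dist_sq {c : ℝ} (hc : 0 ≤ c) (x y : X) :
    ENNReal.ofReal (c * dist x y ^ 2) = ENNReal.ofReal c * edist x y ^ 2 := by
  rw [ENNReal.ofReal_mul hc, ENNReal.ofReal_pow dist_nonneg, ← edist_dist]

variable [MeasurableSpace X] [BorelSpace X]

lemma W2sq_dirac [SecondCountableTopology X] (o : X) (μ : Measure X) [IsProbabilityMeasure μ] :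
    W2sq (Measure.dirac o) μ = ∫⁻ y, edist o y ^ 2 ∂μ := by
  apply le_antisymm
  · refine (iInf₂_le ((Measure.dirac o).prod μ) (by simp)).trans
      ((iInf_le _ (by simp)).trans ?_)
    rw [Measure.dirac_prod, lintegral_map (by fun_prop) (by fun_prop)]
  · refine le_iInf fun π => le_iInf fun h1 => le_iInf fun h2 => ?_
    rw [← h2, lintegral_map (by fun_prop) measurable_snd]
    apply lintegral_mono_ae
    have : ∀ᵐ x ∂(π.map Prod.fst), x = o := by
      rw [h1]
      exact (ae_dirac_iff (measurableSet_singleton o)).2 rfl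
    filter_upwards [ae_of_ae_map measurable_fst.aemeasurable this] with p hp
    rw [← hp]

/-- Two measures along a `W₂`-geodesic issuing from a Dirac mass admit couplings whose average
ray defect is arbitrarily small. -/
lemma exists_coupling_rayDefect_le [SecondCountableTopology X] {μ : ℝ → Measure X}
    (hμ : IsW2Geo μ) {o : X} (h0 : μ 0 = Measure.dirac o) (hW : W2sq (μ 0) (μ 1) ≠ ⊤)
    {q r : ℝ} (hq : 0 < q) (hqr : q < r) (hr : r ≤ 1) {δ : ℝ≥0∞} (hδ : δ ≠ 0) :
    ∃ π : Measure (X × X), π.map Prod.fst = μ q ∧ π.map Prod.snd = μ r ∧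
      ∫⁻ p, ENNReal.ofReal (rayDefect o q r p) ∂π ≤ δ := by
  set W := W2sq (μ 0) (μ 1) with hWdef
  have hr0 : 0 < r := hq.trans hqr
  have hd : 0 < r - q := sub_pos.2 hqr
  have second : ∀ u ∈ Set.Icc (0:ℝ) 1, ∫⁻ y, edist o y ^ 2 ∂(μ u) = ENNReal.ofReal (u ^ 2) * W := by
    intro u hu
    have := hμ.prob u hu
    rw [← W2sq_dirac, ← h0, hμ.geo 0 (by simp) u hu]
    simp [hWdef]
  have hqI : q ∈ Set.Icc (0:ℝ) 1 := ⟨hq.le, hqr.le.trans hr⟩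
  have hrI : r ∈ Set.Icc (0:ℝ) 1 := ⟨hr0.le, hr⟩
  have hgeo := hμ.geo q hqI r hrI
  have hfin : W2sq (μ q) (μ r) < ⊤ := by
    rw [hgeo]; exact ENNReal.mul_lt_top ENNReal.ofReal_lt_top hW.lt_top
  obtain ⟨δ', hδ', hle⟩ : ∃ δ' : ℝ≥0∞, δ' ≠ 0 ∧ ENNReal.ofReal (r * q) * δ' ≤ δ := by
    have hc : ENNReal.ofReal (r * q) ≠ 0 := by
      rw [Ne, ENNReal.ofReal_eq_zero, not_le]; positivity
    exact ⟨δ / ENNReal.ofReal (r * q), ENNReal.div_ne_zero.2 ⟨hδ, ENNReal.ofReal_ne_top⟩,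
      ENNReal.mul_div_le⟩
  have hlt : W2sq (μ q) (μ r) < W2sq (μ q) (μ r) + δ' := ENNReal.lt_add_right hfin.ne hδ'
  conv_lhs at hlt => rw [W2sq]
  simp only [iInf_lt_iff] at hlt
  obtain ⟨π, h1, h2, hπ⟩ := hlt
  refine ⟨π, h1, h2, le_trans ?_ hle⟩
  have i1 : ∫⁻ p, edist o p.1 ^ 2 ∂π = ENNReal.ofReal (q ^ 2) * W := by
    rw [← second q hqI, ← h1, lintegral_map (by fun_prop) measurable_fst]
  have i2 : ∫⁻ p, edist o p.2 ^ 2 ∂π = ENNReal.ofReal (r ^ 2) * W := by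
    rw [← second r hrI, ← h2, lintegral_map (by fun_prop) measurable_snd]
  have pointwise : ∀ p : X × X,
      ENNReal.ofReal (q * (r - q)) * edist o p.2 ^ 2 + ENNReal.ofReal (rayDefect o q r p) =
        ENNReal.ofReal (r * (r - q)) * edist o p.1 ^ 2 +
          ENNReal.ofReal (r * q) * edist p.1 p.2 ^ 2 := by
    intro p
    rw [← ofReal_mul_dist_sq (by positivity), ← ofReal_mul_dist_sq (by positivity),
      ← ofReal_mul_dist_sq (by positivity),
      ← ENNReal.ofReal_add (by positivity) (rayDefect_nonneg o hq.le hqr.le p),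
      ← ENNReal.ofReal_add (by positivity) (by positivity)]
    congr 1
    unfold rayDefect; ring
  have hint := congrArg (fun f => ∫⁻ p, f p ∂π) (funext pointwise)
  simp only at hint
  rw [lintegral_add_left (by fun_prop), lintegral_add_left (by fun_prop),
    lintegral_const_mul _ (by fun_prop), lintegral_const_mul _ (by fun_prop),
    lintegral_const_mul _ (by fun_prop), i1, i2] at hint
  have hbound : ENNReal.ofReal (q * (r - q)) * (ENNReal.ofReal (r ^ 2) * W) +
      ∫⁻ p, ENNReal.ofReal (rayDefect o q r p) ∂π ≤
      ENNReal.ofReal (q * (r - q)) * (ENNReal.ofReal (r ^ 2) * W) +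
        ENNReal.ofReal (r * q) * δ' := by
    rw [hint]
    calc _ ≤ ENNReal.ofReal (r * (r - q)) * (ENNReal.ofReal (q ^ 2) * W) +
          ENNReal.ofReal (r * q) * (ENNReal.ofReal ((q - r) ^ 2) * W + δ') := by
            rw [← hgeo]; gcongr
      _ = _ := by
        rw [mul_add, ← add_assoc, ← mul_assoc, ← mul_assoc, ← mul_assoc, ← add_mul,
          ← ENNReal.ofReal_mul (by positivity), ← ENNReal.ofReal_mul (by positivity),
          ← ENNReal.ofReal_mul (by positivity),
          ← ENNReal.ofReal_add (by positivity) (by positivity)]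
        congr 4
        ring
  exact ENNReal.le_of_add_le_add_left
    (ENNReal.mul_ne_top ENNReal.ofReal_ne_top (ENNReal.mul_ne_top ENNReal.ofReal_ne_top hW)) hbound

/-- Along a `W₂`-geodesic issuing from a Dirac mass, mass sitting on a compact set at time `q`
is transported at time `r` onto the points lying further on the same rays. -/
lemma measure_le_measure_onRay [SecondCountableTopology X] [CompleteSpace X] {μ : ℝ → Measure X}
    (hμ : IsW2Geo μ) {o : X} (h0 : μ 0 = Measure.dirac o) (hW : W2sq (μ 0) (μ 1) ≠ ⊤)
    {q r : ℝ} (hq : 0 ≤ q) (hqr : q < r) (hr : r ≤ 1) {S K : Set X}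
    (hS : IsCompact S) (hK : IsCompact K) :
    μ q S ≤ μ r (Prod.snd '' (S ×ˢ K ∩ {p | OnRay o q r p.1 p.2})) + μ r Kᶜ := by
  set T := Prod.snd '' (S ×ˢ K ∩ {p : X × X | OnRay o q r p.1 p.2}) with hT
  have := hμ.prob r ⟨hq.trans hqr.le, hr⟩
  rcases hq.eq_or_lt with rfl | hq
  · by_cases ho : o ∈ S
    · have hKT : K ⊆ T := fun y hy => ⟨(o, y), ⟨⟨ho, hy⟩, OnRay.zero o r y⟩, rfl⟩
      calc μ 0 S ≤ 1 := by rw [h0]; exact prob_le_one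
        _ = μ r K + μ r Kᶜ := (prob_add_prob_compl hK.measurableSet).symm
        _ ≤ _ := by gcongr
    · rw [h0, Measure.dirac_apply' _ hS.measurableSet]
      simp [ho]
  refine ENNReal.le_of_forall_pos_le_add fun ε hε _ => ?_
  have hε2 : (ε : ℝ≥0∞) / 2 ≠ 0 := by simpa using hε.ne'
  obtain ⟨U, hTU, hUo, hU⟩ := T.exists_isOpen_lt_add (measure_ne_top (μ r) T) hε2
  have hC : IsCompact (S ×ˢ (K \ U)) := hS.prod (hK.diff hUo)
  obtain ⟨η, hη, hQ⟩ : ∃ η : ℝ, 0 < η ∧ ∀ p ∈ S ×ˢ (K \ U), η ≤ rayDefect o q r p := by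
    rcases (S ×ˢ (K \ U)).eq_empty_or_nonempty with h | h
    · exact ⟨1, one_pos, by simp [h]⟩
    · obtain ⟨p, hp, hmin⟩ := hC.exists_isMinOn h (continuous_rayDefect o q r).continuousOn
      refine ⟨_, ?_, fun p' hp' => hmin hp'⟩
      by_contra hle
      exact hp.2.2 (hTU ⟨p, ⟨⟨hp.1, hp.2.1⟩, OnRay.of_rayDefect hq hqr (not_lt.1 hle)⟩, rfl⟩)
  have hη' : ENNReal.ofReal η ≠ 0 := by simpa using hη
  obtain ⟨π, h1, h2, hπ⟩ := exists_coupling_rayDefect_le hμ h0 hW hq hqr hr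
    (mul_ne_zero hη' hε2)
  have hCle : π (S ×ˢ (K \ U)) ≤ ε / 2 := by
    calc π (S ×ˢ (K \ U))
        ≤ π {p | ENNReal.ofReal η ≤ ENNReal.ofReal (rayDefect o q r p)} :=
          measure_mono fun p hp => ENNReal.ofReal_le_ofReal (hQ p hp)
      _ ≤ _ := meas_ge_le_lintegral_div
          ((continuous_rayDefect o q r).measurable.ennreal_ofReal.aemeasurable) hη'
          ENNReal.ofReal_ne_top
      _ ≤ ε / 2 := ENNReal.div_le_of_le_mul (by rwa [mul_comm])
  calc μ q S = π (Prod.fst ⁻¹' S) := by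
        rw [← h1, Measure.map_apply measurable_fst hS.measurableSet]
    _ ≤ π (S ×ˢ (K \ U) ∪ Prod.snd ⁻¹' U ∪ Prod.snd ⁻¹' Kᶜ) := by
        apply measure_mono
        rintro ⟨x, y⟩ hx
        by_cases hy : y ∈ K <;> by_cases hy' : y ∈ U <;> simp_all
    _ ≤ π (S ×ˢ (K \ U)) + π (Prod.snd ⁻¹' U) + π (Prod.snd ⁻¹' Kᶜ) :=
        (measure_union_le _ _).trans (by gcongr; exact measure_union_le _ _)
    _ ≤ ε / 2 + μ r U + μ r Kᶜ := by
        rw [← h2, Measure.map_apply measurable_snd hUo.measurableSet,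
          Measure.map_apply measurable_snd hK.measurableSet.compl]
        gcongr
    _ ≤ ε / 2 + (μ r T + ε / 2) + μ r Kᶜ := by gcongr
    _ = μ r T + μ r Kᶜ + ε := by
        conv_rhs => rw [← ENNReal.add_halves (ε : ℝ≥0∞)]
        ring

/-- Finite chains of points lying on rays from `o`, with prescribed compact constraints. -/
lemma exists_compact_finite_chain [SecondCountableTopology X] [CompleteSpace X]
    {μ : ℝ → Measure X} (hμ : IsW2Geo μ) {o : X} (h0 : μ 0 = Measure.dirac o)
    (hW : W2sq (μ 0) (μ 1) ≠ ⊤) {K : unitInterval → Set X} (hK : ∀ q, IsCompact (K q))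
    (F : Finset unitInterval) (hF : F.Nonempty) :
    ∃ u ∈ F, (∀ q ∈ F, q ≤ u) ∧ ∃ S : Set X, IsCompact S ∧
      1 ≤ μ u S + ∑ q ∈ F, μ q (K q)ᶜ ∧ ∀ z ∈ S, ∃ x : unitInterval → X, x u = z ∧
        (∀ q ∈ F, x q ∈ K q) ∧ ∀ q ∈ F, ∀ r ∈ F, q < r → OnRay o q r (x q) (x r) := by
  classical
  induction F using Finset.induction_on_max with
  | empty => exact absurd hF Finset.not_nonempty_empty
  | insert a s has ih =>
    have hnot : a ∉ s := fun h => lt_irrefl _ (has a h)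
    rcases s.eq_empty_or_nonempty with rfl | hs
    · refine ⟨a, by simp, by simp, K a, hK a, ?_, fun z hz => ⟨fun _ => z, rfl, ?_, ?_⟩⟩
      · have := hμ.prob a a.2
        simp [prob_add_prob_compl (hK a).measurableSet]
      · simpa using hz
      · intro q hq r hr hqr
        simp only [insert_empty_eq, Finset.mem_singleton] at hq hr
        exact absurd hqr (by simp [hq, hr])
    · obtain ⟨u, hu, hmax, S, hS, hmass, hchain⟩ := ih hs
      have hua := has u hu
      refine ⟨a, by simp, ?_, Prod.snd '' (S ×ˢ K a ∩ {p | OnRay o u a p.1 p.2}), ?_, ?_, ?_⟩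
      · intro q hq
        rcases Finset.mem_insert.1 hq with rfl | hq
        exacts [le_rfl, (has q hq).le]
      · exact ((hS.prod (hK a)).inter_right (isClosed_onRay o u a)).image continuous_snd
      · rw [Finset.sum_insert hnot, ← add_assoc]
        refine hmass.trans ?_
        gcongr
        exact measure_le_measure_onRay hμ h0 hW u.2.1 hua a.2.2 hS (hK a)
      · rintro _ ⟨⟨y, z⟩, ⟨⟨hy, hz⟩, hyz⟩, rfl⟩
        obtain ⟨x, hxu, hxK, hxR⟩ := hchain y hy
        have hne : ∀ q ∈ s, q ≠ a := fun q hq => (has q hq).ne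
        have hlast : ∀ q ∈ s, OnRay o q a (x q) z := by
          intro q hq
          rcases (hmax q hq).eq_or_lt with rfl | hlt
          · rw [hxu]; exact hyz
          · exact (hxR q hq u hu hlt).trans q.2.1 hlt (by rw [hxu]; exact hyz)
        refine ⟨Function.update x a z, by simp, ?_, ?_⟩
        · intro q hq
          rcases Finset.mem_insert.1 hq with rfl | hq
          · simpa using hz
          · rw [Function.update_of_ne (hne q hq)]; exact hxK q hq
        · intro q hq r hr hqr
          rcases Finset.mem_insert.1 hq with rfl | hqs
          · rcases Finset.mem_insert.1 hr with rfl | hrs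
            · exact absurd hqr (lt_irrefl _)
            · exact absurd hqr (has r hrs).asymm
          · rw [Function.update_of_ne (hne q hqs)]
            rcases Finset.mem_insert.1 hr with rfl | hrs
            · simpa using hlast q hqs
            · rw [Function.update_of_ne (hne r hrs)]; exact hxR q hqs r hrs hqr

/-- Chains of points lying on rays from `o`, indexed by an arbitrary set of times. -/
lemma exists_chain [SecondCountableTopology X] [CompleteSpace X]
    {μ : ℝ → Measure X} (hμ : IsW2Geo μ) {o : X} (h0 : μ 0 = Measure.dirac o)
    (hW : W2sq (μ 0) (μ 1) ≠ ⊤) (D : Set unitInterval) {K : D → Set X}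
    (hK : ∀ q, IsCompact (K q)) (hsum : ∑' q : D, μ (q : unitInterval) (K q)ᶜ < 1) :
    ∃ x : D → X, (∀ q, x q ∈ K q) ∧
      ∀ q r : D, q < r → OnRay o (q : unitInterval) (r : unitInterval) (x q) (x r) := by
  classical
  have hKne : ∀ q, (K q).Nonempty := by
    intro q
    by_contra h
    rw [Set.not_nonempty_iff_eq_empty] at h
    have := hμ.prob (q : unitInterval) q.1.2
    have h1 := (ENNReal.le_tsum (f := fun q : D => μ (q : unitInterval) (K q)ᶜ) q).trans_lt hsum
    simp [h] at h1
  choose y hy using hKne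
  let E : Finset D → Set (D → X) := fun F =>
    Set.univ.pi K ∩ {x | ∀ q ∈ F, ∀ r ∈ F, q < r →
      OnRay o (q : unitInterval) (r : unitInterval) (x q) (x r)}
  have hclosed : ∀ F : Finset D, IsClosed {x : D → X | ∀ q ∈ F, ∀ r ∈ F, q < r →
      OnRay o (q : unitInterval) (r : unitInterval) (x q) (x r)} := by
    intro F
    simp only [Set.ofPred_forall]
    refine isClosed_iInter fun q => isClosed_iInter fun _ => isClosed_iInter fun r =>
      isClosed_iInter fun _ => isClosed_iInter fun _ => ?_
    exact IsClosed.preimage (f := fun x : D → X => (x q, x r))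
      ((continuous_apply q).prodMk (continuous_apply r)) (isClosed_onRay o q r)
  have hcomp : ∀ F, IsCompact (E F) := fun F => (isCompact_univ_pi hK).inter_right (hclosed F)
  have hne : ∀ F, (E F).Nonempty := by
    intro F
    rcases F.eq_empty_or_nonempty with rfl | hF
    · exact ⟨y, fun q _ => hy q, by simp⟩
    let K' : unitInterval → Set X := fun q => if h : q ∈ D then K ⟨q, h⟩ else ∅
    have hK'D : ∀ q : D, K' q = K q := fun q => by simp [K']
    have hK' : ∀ q, IsCompact (K' q) := by
      intro q
      by_cases h : q ∈ D
      · simpa [K', h] using hK ⟨q, h⟩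
      · simp [K', h]
    obtain ⟨u, -, -, S, -, hmass, hS⟩ := exists_compact_finite_chain hμ h0 hW hK'
      (F.map (Function.Embedding.subtype _)) (by simpa using hF)
    have hlt : ∑ q ∈ F.map (Function.Embedding.subtype (· ∈ D)), μ q (K' q)ᶜ < 1 := by
      rw [Finset.sum_map]
      simp only [Function.Embedding.subtype_apply, hK'D]
      exact (ENNReal.sum_le_tsum F).trans_lt hsum
    obtain ⟨z, hz⟩ : S.Nonempty := by
      by_contra h
      rw [Set.not_nonempty_iff_eq_empty] at h
      simp only [h, measure_empty, zero_add] at hmass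
      exact hmass.not_gt hlt
    obtain ⟨x, -, hxK, hxR⟩ := hS z hz
    have hmem : ∀ q ∈ F, (q : unitInterval) ∈ F.map (Function.Embedding.subtype (· ∈ D)) :=
      fun q hq => Finset.mem_map_of_mem (Function.Embedding.subtype (· ∈ D)) hq
    refine ⟨fun q => if q ∈ F then x q else y q, fun q _ => ?_, fun q hq r hr hqr => ?_⟩
    · by_cases hq : q ∈ F
      · simpa [hq, hK'D] using hxK q (hmem q hq)
      · simpa [hq] using hy q
    · simpa only [hq, hr, if_true] using hxR q (hmem q hq) r (hmem r hr) hqr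
  have hdir : Directed (· ⊇ ·) E := by
    intro F F'
    refine ⟨F ∪ F', fun x hx => ⟨hx.1, fun q hq r hr => ?_⟩,
      fun x hx => ⟨hx.1, fun q hq r hr => ?_⟩⟩
    · exact hx.2 q (Finset.mem_union_left _ hq) r (Finset.mem_union_left _ hr)
    · exact hx.2 q (Finset.mem_union_right _ hq) r (Finset.mem_union_right _ hr)
  obtain ⟨x, hx⟩ := IsCompact.nonempty_iInter_of_directed_nonempty_isCompact_isClosed E hdir hne
    hcomp (fun F => (hcomp F).isClosed)
  rw [Set.mem_iInter] at hx
  exact ⟨x, fun q => (hx ∅).1 q trivial, fun q r hqr =>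
    (hx {q, r}).2 q (by simp) r (by simp) hqr⟩

/-- Along a `W₂`-geodesic issuing from a Dirac mass, the intermediate measures are concentrated
on the intermediate points. -/
lemma measure_compl_eq_zero_of_Zt_subset [SecondCountableTopology X] [CompleteSpace X]
    {μ : ℝ → Measure X} (hμ : IsW2Geo μ) {o : X} (h0 : μ 0 = Measure.dirac o)
    (hW : W2sq (μ 0) (μ 1) ≠ ⊤) {B : Set X} (hB : MeasurableSet B) (hμB : μ 1 Bᶜ = 0)
    {t : ℝ} (ht : t ∈ Set.Ioo (0:ℝ) 1) {S : Set X} (hS : MeasurableSet S)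
    (hZ : Zt t {o} B ⊆ S) : μ t Sᶜ = 0 := by
  classical
  by_contra hpos
  have hprob : ∀ q : unitInterval, IsProbabilityMeasure (μ q) := fun q => hμ.prob q q.2
  let τ : unitInterval := ⟨t, ht.1.le, ht.2.le⟩
  have : IsProbabilityMeasure (μ t) := hprob τ
  obtain ⟨D₀, hD₀c, hD₀⟩ := TopologicalSpace.exists_countable_dense unitInterval
  set D : Set unitInterval := D₀ ∪ {0, 1, τ} with hDdef
  have hDc : D.Countable := hD₀c.union (Set.to_countable _)
  have hD : Dense D := hD₀.mono Set.subset_union_left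
  have h0D : (0 : unitInterval) ∈ D := by simp [hDdef]
  have h1D : (1 : unitInterval) ∈ D := by simp [hDdef]
  have hτD : τ ∈ D := by simp [hDdef]
  have hτ1 : τ ≠ 1 := fun h => ht.2.ne (congrArg Subtype.val h)
  have := hDc.to_subtype
  obtain ⟨ε, hε, hεsum⟩ := ENNReal.exists_pos_sum_of_countable' hpos D
  let V : D → Set X := fun q => if (q : unitInterval) = τ then Sᶜ else
    if (q : unitInterval) = 1 then B else Set.univ
  have hV : ∀ q, MeasurableSet (V q) := by
    intro q
    simp only [V]
    split_ifs
    exacts [hS.compl, hB, MeasurableSet.univ]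
  have hKex : ∀ q : D, ∃ K ⊆ V q, IsCompact K ∧ μ (q : unitInterval) (V q \ K) < ε q := fun q =>
    (hV q).exists_isCompact_sdiff_lt (measure_ne_top _ _) (hε q).ne'
  choose K hKV hK hKε using hKex
  have hterm : ∀ q : D, μ (q : unitInterval) (K q)ᶜ ≤
      (if q = ⟨τ, hτD⟩ then μ t S else 0) + ε q := by
    intro q
    have hsub : (K q)ᶜ ⊆ (V q)ᶜ ∪ V q \ K q := by
      intro y hy
      by_cases h : y ∈ V q
      exacts [Or.inr ⟨h, hy⟩, Or.inl h]
    refine ((measure_mono hsub).trans (measure_union_le _ _)).trans ?_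
    gcongr
    · by_cases hq : q = ⟨τ, hτD⟩
      · subst hq; simp [V, τ]
      · have hq' : (q : unitInterval) ≠ τ := fun h => hq (Subtype.ext h)
        by_cases hq1 : (q : unitInterval) = 1
        · simp [V, hq, hq1, hτ1.symm, hμB]
        · simp [V, hq, hq', hq1]
    · exact (hKε q).le
  have hsum : ∑' q : D, μ (q : unitInterval) (K q)ᶜ < 1 := by
    calc _ ≤ ∑' q : D, ((if q = ⟨τ, hτD⟩ then μ t S else 0) + ε q) := ENNReal.tsum_le_tsum hterm
      _ = μ t S + ∑' q, ε q := by rw [ENNReal.tsum_add, tsum_ite_eq]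
      _ < μ t S + μ t Sᶜ := ENNReal.add_lt_add_left (measure_ne_top _ _) hεsum
      _ = 1 := prob_add_prob_compl hS
  obtain ⟨x, hxK, hxR⟩ := exists_chain hμ h0 hW D hK hsum
  set L := dist o (x ⟨1, h1D⟩) with hLdef
  have hrad : ∀ q : D, dist o (x q) = (q : unitInterval) * L := by
    intro q
    rcases q.1.2.2.eq_or_lt with h | h
    · have : q = ⟨1, h1D⟩ := Subtype.ext (Subtype.ext h)
      subst this; simp [hLdef]
    · simpa using (hxR q ⟨1, h1D⟩ h).1.symm
  have hx0 : x ⟨0, h0D⟩ = o := by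
    simpa using (dist_eq_zero.1 (by simpa using hrad ⟨0, h0D⟩)).symm
  have hlt : ∀ q r : D, q < r → dist (x q) (x r) =
      |((q : unitInterval) : ℝ) - (r : unitInterval)| * L := by
    intro q r hqr
    have hqr' : ((q : unitInterval) : ℝ) < (r : unitInterval) := hqr
    rw [abs_sub_comm, abs_of_pos (sub_pos.2 hqr')]
    rcases q.1.2.1.eq_or_lt with h | h
    · have hq : q = ⟨0, h0D⟩ := Subtype.ext (Subtype.ext h.symm)
      subst hq
      rw [hx0, hrad]; simp
    · have h2 := (hxR q r hqr).2
      rw [hrad q] at h2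
      apply mul_left_cancel₀ h.ne'
      linear_combination h2
  obtain ⟨γ, hγ⟩ := exists_geodesic_extension hD h0D h1D x L fun q r => by
    rcases lt_trichotomy q r with h | rfl | h
    · exact hlt q r h
    · simp
    · rw [dist_comm, abs_sub_comm]; exact hlt r q h
  have hτS : x ⟨τ, hτD⟩ ∉ S := by
    have := hKV _ (hxK ⟨τ, hτD⟩)
    simpa [V] using this
  have h1B : x ⟨1, h1D⟩ ∈ B := by
    have := hKV _ (hxK ⟨1, h1D⟩)
    simpa [V, hτ1.symm] using this
  apply hτS
  refine hZ ⟨γ, ?_, ?_, ?_⟩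
  · simp only [geval, Set.projIcc_left]
    exact (hγ ⟨0, h0D⟩).trans hx0
  · simp only [geval, Set.projIcc_right]
    exact (hγ ⟨1, h1D⟩).symm ▸ h1B
  · simp only [geval]
    rw [Set.projIcc_of_mem zero_le_one (show t ∈ Set.Icc (0:ℝ) 1 from τ.2)]
    exact hγ ⟨τ, hτD⟩

end Transport

section Entropy

lemma epos_mono {x y : EReal} (h : x ≤ y) : epos x ≤ epos y := by
  unfold epos
  split_ifs with hx hy hy
  · exact le_rfl
  · exact absurd (top_le_iff.1 (hx ▸ h)) hy
  · exact le_top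
  · rcases eq_or_ne x ⊥ with rfl | hx'
    · simp
    · exact ENNReal.ofReal_le_ofReal (EReal.toReal_le_toReal h hx' hy)

lemma epos_sub_epos_neg {c : EReal} (hc : c ≠ ⊥) :
    ((epos c : ℝ≥0∞) : EReal) - ((epos (-c) : ℝ≥0∞) : EReal) = c := by
  induction c with
  | bot => exact absurd rfl hc
  | top => simp [epos]
  | coe c =>
    rw [← EReal.coe_neg]
    simp only [epos, EReal.coe_ne_top, if_false, EReal.toReal_coe, EReal.coe_ennreal_ofReal]
    rw [← EReal.coe_sub]
    congr 1
    rcases le_total 0 c with h | h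
    · rw [max_eq_left h, max_eq_right (by linarith)]; ring
    · rw [max_eq_right h, max_eq_left (by linarith)]; ring

lemma le_eintegral {α : Type*} [MeasurableSpace α] (ν : Measure α) [IsProbabilityMeasure ν]
    {f : α → EReal} {c : EReal} (h : ∀ᵐ a ∂ν, c ≤ f a) : c ≤ eintegral ν f := by
  rcases eq_or_ne c ⊥ with rfl | hc
  · exact bot_le
  have h1 : epos c ≤ ∫⁻ a, epos (f a) ∂ν := by
    calc epos c = ∫⁻ _, epos c ∂ν := by simp
      _ ≤ _ := lintegral_mono_ae (h.mono fun a ha => epos_mono ha)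
  have h2 : ∫⁻ a, epos (-(f a)) ∂ν ≤ epos (-c) := by
    calc _ ≤ ∫⁻ _, epos (-c) ∂ν :=
          lintegral_mono_ae (h.mono fun a ha => epos_mono (EReal.neg_le_neg_iff.2 ha))
      _ = _ := by simp
  calc c = ((epos c : ℝ≥0∞) : EReal) - ((epos (-c) : ℝ≥0∞) : EReal) := (epos_sub_epos_neg hc).symm
    _ ≤ _ := EReal.sub_le_sub (by exact_mod_cast h1) (by exact_mod_cast h2)

variable [MeasurableSpace X]

lemma UnE_one (μ m : Measure X) : UnE 1 μ m = EReal.exp (-(Ent μ m)) := by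
  simp [UnE]

/-- Jensen's inequality for the entropy. -/
lemma UnE_one_le (m μ : Measure X) [SigmaFinite m] [IsProbabilityMeasure μ] {S : Set X}
    (hS : MeasurableSet S) (hμS : μ Sᶜ = 0) : UnE 1 μ m ≤ m S := by
  rw [UnE_one, Ent]
  split_ifs with h
  swap
  · simp
  obtain ⟨hac, hint⟩ := h
  rcases eq_or_ne (m S) ⊤ with htop | htop
  · rw [htop]; exact le_top
  have hμS1 : μ S = 1 := by rw [← prob_compl_eq_zero_iff hS, hμS]
  have hS0 : m S ≠ 0 := fun h => by simp [hac h] at hμS1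
  set M := (m S).toReal with hM
  have hMpos : 0 < M := ENNReal.toReal_pos hS0 htop
  have hρ0 : ∀ᵐ x ∂m, x ∈ Sᶜ → μ.rnDeriv m x = 0 := by
    rw [← ae_restrict_iff' hS.compl]
    have h0 : ∫⁻ x in Sᶜ, μ.rnDeriv m x ∂m = 0 := by
      rw [Measure.setLIntegral_rnDeriv hac, hμS]
    exact (lintegral_eq_zero_iff (Measure.measurable_rnDeriv μ m)).1 h0
  have hρint : Integrable (fun x => (μ.rnDeriv m x).toReal) m := Measure.integrable_toReal_rnDeriv
  have hind : Integrable (S.indicator fun _ => M⁻¹) m :=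
    (integrable_indicator_iff hS).2 (integrableOn_const htop)
  have hpt : ∀ᵐ x ∂m, (μ.rnDeriv m x).toReal - S.indicator (fun _ => M⁻¹) x ≤
      (μ.rnDeriv m x).toReal * Real.log (μ.rnDeriv m x).toReal +
        (μ.rnDeriv m x).toReal * Real.log M := by
    filter_upwards [hρ0] with x hx
    by_cases hxS : x ∈ S
    · rw [Set.indicator_of_mem hxS]
      set ρ := (μ.rnDeriv m x).toReal with hρ
      have hρ' : 0 ≤ ρ := ENNReal.toReal_nonneg
      rcases hρ'.eq_or_lt with h | h
      · simp only [← h, zero_mul, zero_sub, add_zero, neg_nonpos]; positivity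
      · rw [← mul_add, ← Real.log_mul h.ne' hMpos.ne']
        have := mul_le_mul_of_nonneg_left (Real.one_sub_inv_le_log_of_pos (mul_pos h hMpos)) hρ'
        refine le_trans (le_of_eq ?_) this
        field_simp
    · simp [hx hxS, hxS]
  have hle := integral_mono_ae (hρint.sub hind) (hint.add (hρint.mul_const (Real.log M))) hpt
  simp only [Pi.sub_apply, Pi.add_apply] at hle
  rw [integral_sub hρint hind, integral_add hint (hρint.mul_const _), integral_mul_const,
    Measure.integral_toReal_rnDeriv hac, integral_indicator_const _ hS] at hle
  simp only [probReal_univ, one_mul, smul_eq_mul] at hle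
  rw [Measure.real, ← hM, mul_inv_cancel₀ hMpos.ne'] at hle
  rw [← EReal.coe_neg, EReal.exp_coe, ← ENNReal.ofReal_toReal htop, ← hM]
  apply ENNReal.ofReal_le_ofReal
  rw [← Real.le_log_iff_exp_le hMpos]
  linarith

/-- The uniform probability measure on `B` with respect to `m`. -/
def uniformOn (m : Measure X) (B : Set X) : Measure X :=
  m.withDensity (B.indicator fun _ => (m B)⁻¹)

variable {m : Measure X} {B : Set X}

lemma uniformOn_apply (hB : MeasurableSet B) {s : Set X} (hs : MeasurableSet s) :
    uniformOn m B s = (m B)⁻¹ * m (B ∩ s) := by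
  rw [uniformOn, withDensity_apply _ hs, lintegral_indicator hB, lintegral_const,
    Measure.restrict_restrict hB, Measure.restrict_apply_univ]

lemma uniformOn_absolutelyContinuous : uniformOn m B ≪ m :=
  withDensity_absolutelyContinuous _ _

lemma isProbabilityMeasure_uniformOn (hB : MeasurableSet B) (h0 : m B ≠ 0) (h1 : m B ≠ ⊤) :
    IsProbabilityMeasure (uniformOn m B) :=
  ⟨by rw [uniformOn_apply hB MeasurableSet.univ, Set.inter_univ, ENNReal.inv_mul_cancel h0 h1]⟩

lemma uniformOn_compl (hB : MeasurableSet B) : uniformOn m B Bᶜ = 0 := by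
  rw [uniformOn_apply hB hB.compl]; simp

lemma Ent_uniformOn [SigmaFinite m] (hB : MeasurableSet B) (h0 : m B ≠ 0) (h1 : m B ≠ ⊤) :
    Ent (uniformOn m B) m = ((-Real.log (m B).toReal : ℝ) : EReal) := by
  have hMpos : 0 < (m B).toReal := ENNReal.toReal_pos h0 h1
  have hae : (fun x => ((uniformOn m B).rnDeriv m x).toReal *
      Real.log ((uniformOn m B).rnDeriv m x).toReal) =ᵐ[m]
      B.indicator fun _ => (m B).toReal⁻¹ * -Real.log (m B).toReal := by
    filter_upwards [Measure.rnDeriv_withDensity m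
      ((measurable_const (a := (m B)⁻¹)).indicator hB)] with x hx
    rw [uniformOn, hx]
    by_cases hxB : x ∈ B <;> simp [hxB]
  have hint : Integrable (B.indicator fun _ => (m B).toReal⁻¹ * -Real.log (m B).toReal) m :=
    (integrable_indicator_iff hB).2 (integrableOn_const h1)
  rw [Ent, if_pos ⟨uniformOn_absolutelyContinuous, hint.congr hae.symm⟩, integral_congr_ae hae,
    integral_indicator_const _ hB, Measure.real, smul_eq_mul, mul_inv_cancel_left₀ hMpos.ne']

lemma UnE_one_uniformOn [SigmaFinite m] (hB : MeasurableSet B) (h0 : m B ≠ 0) (h1 : m B ≠ ⊤) :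
    UnE 1 (uniformOn m B) m = m B := by
  rw [UnE_one, Ent_uniformOn hB h0 h1, EReal.coe_neg, neg_neg, EReal.exp_coe,
    Real.exp_log (ENNReal.toReal_pos h0 h1), ENNReal.ofReal_toReal h1]

end Entropy

section Support

variable [MetricSpace X] [MeasurableSpace X] {m : Measure X} {B : Set X}

lemma measure_compl_mSupp [SecondCountableTopology X] (m : Measure X) : m (mSupp m)ᶜ = 0 := by
  refine measure_null_of_locally_null _ fun x hx => ?_
  simp only [mSupp, Set.mem_compl_iff, Set.mem_ofPred_eq, not_forall, not_lt, nonpos_iff_eq_zero]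
    at hx
  obtain ⟨r, hr, h⟩ := hx
  exact ⟨_, mem_nhdsWithin_of_mem_nhds (Metric.ball_mem_nhds x hr), h⟩

lemma FiniteOnBounded.sigmaFinite (hm : FiniteOnBounded m) (x : X) : SigmaFinite m :=
  ⟨⟨{ set := fun n => Metric.ball x n
      set_mem := fun _ => trivial
      finite := fun _ => hm _ Metric.isBounded_ball
      spanning := Metric.iUnion_ball_nat x }⟩⟩

lemma mSupp_uniformOn_subset_closure [BorelSpace X] (hB : MeasurableSet B) :
    mSupp (uniformOn m B) ⊆ closure B := by
  intro y hy
  rw [Metric.mem_closure_iff]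
  intro r hr
  by_contra! h
  have hy' := hy r hr
  rw [uniformOn_apply hB measurableSet_ball] at hy'
  have : B ∩ Metric.ball y r = ∅ := by
    ext z
    simp only [Set.mem_inter_iff, Metric.mem_ball, Set.mem_empty_iff_false, iff_false, not_and,
      not_lt]
    intro hz
    rw [dist_comm]; exact h z hz
  simp [this] at hy'

lemma mSupp_uniformOn_subset (m : Measure X) (B : Set X) : mSupp (uniformOn m B) ⊆ mSupp m :=
  fun _ hy r hr => pos_iff_ne_zero.2 fun h => (hy r hr).ne' (uniformOn_absolutelyContinuous h)

lemma uniformOn_mem_PbsStar [BorelSpace X] [SigmaFinite m] (hB : MeasurableSet B) (hb : Bornology.IsBounded B)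
    (h0 : m B ≠ 0) (h1 : m B ≠ ⊤) : uniformOn m B ∈ PbsStar m :=
  ⟨⟨isProbabilityMeasure_uniformOn hB h0 h1,
    hb.closure.subset (mSupp_uniformOn_subset_closure hB), mSupp_uniformOn_subset m B⟩, by
      rw [Ent_uniformOn hB h0 h1]; exact EReal.coe_ne_top _⟩

lemma lintegral_edist_sq_ne_top {μ : Measure X} [IsFiniteMeasure μ] {o : X} {R : ℝ}
    (h : ∀ᵐ y ∂μ, dist y o < R) : ∫⁻ y, edist o y ^ 2 ∂μ ≠ ⊤ := by
  refine ((lintegral_mono_ae (g := fun _ => ENNReal.ofReal R ^ 2) ?_).trans_lt ?_).ne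
  · filter_upwards [h] with y hy
    rw [edist_comm, edist_dist]
    gcongr
  · rw [lintegral_const]
    exact ENNReal.mul_lt_top (by simp) (measure_lt_top _ _)

end Support

/-- The half-Brunn–Minkowski inequality for bounded sets at positive distance from the
base point. -/
lemma mul_measure_le_measure_Zt [MetricSpace X] [MeasurableSpace X]
    [BorelSpace X] [CompleteSpace X] [SecondCountableTopology X]
    {m : Measure X} (hm : FiniteOnBounded m) {G : X → X → ℝ≥0∞}
    {b : ℝ → ℝ≥0∞ → ℝ≥0∞} (hMCP : MCP m G b) {o : X} (ho : o ∈ mSupp m)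
    {B : Set X} (hB : MeasurableSet B) {r R : ℝ} (hr : 0 < r)
    (hBR : B ⊆ Metric.ball o R \ Metric.ball o r) {t : ℝ} (ht : t ∈ Set.Ioo (0:ℝ) 1)
    {c : ℝ≥0∞} (hc : ∀ᵐ y ∂m, y ∈ B → c ≤ b t (G o y)) :
    c * m B ≤ m (Zt t {o} B) := by
  rcases eq_or_ne (m B) 0 with h0 | h0
  · simp [h0]
  have hbdd : Bornology.IsBounded B :=
    Metric.isBounded_ball.subset (hBR.trans Set.sdiff_subset)
  have h1 : m B ≠ ⊤ := (hm B hbdd).ne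
  have := hm.sigmaFinite o
  have hprob := isProbabilityMeasure_uniformOn hB h0 h1
  have hcompl := uniformOn_compl (m := m) hB
  have haeB : ∀ᵐ y ∂(uniformOn m B), y ∈ B := mem_ae_iff.2 hcompl
  have hoB : o ∉ mSupp (uniformOn m B) := fun h => by
    obtain ⟨z, hz, hd⟩ := Metric.mem_closure_iff.1 (mSupp_uniformOn_subset_closure hB h) r hr
    exact (hBR hz).2 (by rwa [Metric.mem_ball, dist_comm])
  obtain ⟨μ, hμ, hμ0, hμ1, hineq⟩ := hMCP o ho _ (uniformOn_mem_PbsStar hB hbdd h0 h1) hoB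
  have hW : W2sq (μ 0) (μ 1) ≠ ⊤ := by
    rw [hμ0, hμ1, W2sq_dirac]
    exact lintegral_edist_sq_ne_top (haeB.mono fun y hy => (hBR hy).1)
  have hmain := hineq t ht 1 le_rfl
  rw [UnE_one_uniformOn hB h0 h1] at hmain
  have hcoef : c ≤ EReal.exp (((1⁻¹ : ℝ) : EReal) *
      eintegral (uniformOn m B) fun y => ENNReal.log (b t (G o y))) := by
    rw [inv_one, EReal.coe_one, one_mul]
    calc c = EReal.exp (ENNReal.log c) := (ENNReal.exp_log c).symm
      _ ≤ _ := EReal.exp_le_exp_iff.2 (le_eintegral _ ?_)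
    filter_upwards [uniformOn_absolutelyContinuous.ae_le hc, haeB] with y hy hyB
    exact ENNReal.log_le_log_iff.2 (hy hyB)
  have := hμ.prob t ⟨ht.1.le, ht.2.le⟩
  have hS := measurableSet_toMeasurable m (Zt t {o} B)
  rw [← measure_toMeasurable (Zt t {o} B)]
  calc c * m B ≤ _ := mul_le_mul_left hcoef (m B)
    _ ≤ UnE 1 (μ t) m := hmain
    _ ≤ _ := UnE_one_le m (μ t) hS (measure_compl_eq_zero_of_Zt_subset hμ hμ0 hW hB
      (by rw [hμ1, hcompl]) ht hS (subset_toMeasurable _ _))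

lemma Zt_mono_right [MetricSpace X] {t : ℝ} {A₀ A₁ B₁ : Set X} (h : A₁ ⊆ B₁) :
    Zt t A₀ A₁ ⊆ Zt t A₀ B₁ := by
  rintro x ⟨γ, h0, h1, hx⟩
  exact ⟨γ, h0, h h1, hx⟩

/-- Generalized half-Brunn–Minkowski inequality. -/
theorem generalized_half_brunn_minkowski {X : Type*} [MetricSpace X] [MeasurableSpace X]
    [BorelSpace X] [CompleteSpace X] [TopologicalSpace.SeparableSpace X]
    (m : Measure X) (hm : FiniteOnBounded m) (G : X → X → ℝ≥0∞)
    (s : ℝ → ℝ) (N : ℝ) (hsN : DistortionData s N)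
    (hMCP : MCP m G (beta s N))
    (A : Set X) (hA : MeasurableSet A) (hApos : 0 < m A)
    (xb : X) (hxb : xb ∈ mSupp m) (hxbA : m ({xb} ∩ A) = 0) :
    ∀ t ∈ Set.Ioo (0:ℝ) 1,
      betaSet m G (beta s N t) {xb} A * m A ≤ m (Zt t {xb} A) := by
  intro t ht
  have := UniformSpace.secondCountable_of_separable X
  rw [betaSet]
  simp only [ENNReal.iSup_mul, iSup_le_iff]
  intro A₀ hA₀ hA₀ne _ A₁ hA₁ _ hA₁null
  obtain rfl : A₀ = {xb} := hA₀ne.subset_singleton_iff.1 hA₀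
  set c := ⨅ (x0 : X) (_ : x0 ∈ ({xb} : Set X) ∩ mSupp m) (x1 : X) (_ : x1 ∈ A₁ ∩ mSupp m),
    beta s N t (G x0 x1) with hcdef
  have hc : ∀ᵐ y ∂m, y ∈ A → c ≤ beta s N t (G xb y) := by
    filter_upwards [compl_mem_ae_iff.2 hA₁null, mem_ae_iff.2 (measure_compl_mSupp m)]
      with y hy hys hyA
    have hyA₁ : y ∈ A₁ := by
      by_contra h
      exact hy ⟨hyA, h⟩
    exact (iInf₂_le xb ⟨rfl, hxb⟩).trans (iInf₂_le y ⟨hyA₁, hys⟩)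
  let B : ℕ → Set X := fun n => A ∩ (Metric.ball xb (n + 1) \ Metric.ball xb (1 / ((n : ℝ) + 1)))
  have hBmono : Monotone B := by
    intro n k hnk
    have hnk' : (n : ℝ) ≤ k := by exact_mod_cast hnk
    refine Set.inter_subset_inter_right _ (Set.sdiff_subset_sdiff (Metric.ball_subset_ball ?_)
      (Metric.ball_subset_ball ?_))
    · linarith
    · exact one_div_le_one_div_of_le (by positivity) (by linarith)
  have hBunion : A \ ({xb} ∩ A) ⊆ ⋃ n, B n := by
    rintro y ⟨hyA, hy⟩
    have hpos : 0 < dist y xb := dist_pos.2 fun h => hy ⟨h, hyA⟩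
    obtain ⟨n, hn⟩ := exists_nat_gt (dist y xb)
    obtain ⟨k, hk⟩ := exists_nat_one_div_lt hpos
    have hn' : (n : ℝ) ≤ (max n k : ℕ) := by exact_mod_cast le_max_left n k
    have hk' : (k : ℝ) ≤ (max n k : ℕ) := by exact_mod_cast le_max_right n k
    refine Set.mem_iUnion.2 ⟨max n k, hyA, ?_, ?_⟩
    · rw [Metric.mem_ball]; linarith
    · rw [Metric.mem_ball, not_lt]
      exact (one_div_le_one_div_of_le (by positivity) (by linarith)).trans hk.le
  have hmA : m A ≤ ⨆ n, m (B n) := by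
    rw [← hBmono.measure_iUnion, ← measure_sdiff_null (s := A) hxbA]
    exact measure_mono hBunion
  calc c * m A ≤ c * ⨆ n, m (B n) := by gcongr
    _ = ⨆ n, c * m (B n) := ENNReal.mul_iSup _ _
    _ ≤ m (Zt t {xb} A) := iSup_le fun n => ?_
  refine (mul_measure_le_measure_Zt hm hMCP hxb
    (hA.inter (measurableSet_ball.diff measurableSet_ball)) Nat.one_div_pos_of_nat
    Set.inter_subset_right ht (hc.mono fun y hy h => hy h.1)).trans
    (measure_mono (Zt_mono_right Set.inter_subset_left))

end GMMS
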